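/- Let ε₀ ∈ (0,1), let λ_j ≥ 0 and λ̂_j ≥ 0 for j ∈ [J] satisfy (1 − ε₀)·λ_j ≤ λ̂_j ≤ (1 + ε₀)·λ_j for every j, and let C = (C_ℓ)_{ℓ∈L} be positive capacities. Let x̂ be an optimal solution of the stationary LP ES(λ̂, C). Then the scaled solution x̃ := (1 − ε₀)·x̂ is a feasible solution of ES(λ, C), and its objective value with respect to λ satisfies Σ_j w_j λ_j Σ_{k∈K_j} x̃_{jk} ≥ (1 − 4ε₀) · W_ES(λ, C). -/

import Mathlib

open Finset

variable {V : Type} [Fintype V] [DecidableEq V]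

/-- `L̄`: the links of the network together with all self-loops. -/
def Lbar (L : Finset (V × V)) : Finset (V × V) :=
  L ∪ Finset.univ.image (fun v => (v, v))

/-- A route-schedule for a packet type with source `s`, destination `z` and deadline `d`:
a directed walk `k = (k_0, …, k_d)` of edges of `L̄` with `k_0` going out of `s`
and `k_d` going into `z`. -/
def IsRouteSchedule (L : Finset (V × V)) (s z : V) (d : ℕ)
    (k : Fin (d + 1) → V × V) : Prop :=
  (∀ τ, k τ ∈ Lbar L) ∧
  (∀ τ : Fin (d + 1), ∀ h : (τ : ℕ) + 1 < d + 1, (k τ).2 = (k ⟨(τ : ℕ) + 1, h⟩).1) ∧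
  (k 0).1 = s ∧ (k (Fin.last d)).2 = z

open Classical in
/-- The (finite) set `K` of all route-schedules for source `s`, destination `z`,
deadline `d`. -/
noncomputable def RS (L : Finset (V × V)) (s z : V) (d : ℕ) :
    Finset (Fin (d + 1) → V × V) :=
  Finset.univ.filter (IsRouteSchedule L s z d)

open Classical in
/-- `∑_{k ∈ K : k_τ = ℓ} x_k`, with the convention that the indicator `[k_τ = ℓ]` is `0`
when `τ ∉ {0, …, d}`. -/
noncomputable def schedAt (L : Finset (V × V)) (s z : V) (d : ℕ)
    (x : (Fin (d + 1) → V × V) → ℝ) (τ : ℕ) (ℓ : V × V) : ℝ :=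
  ∑ k ∈ RS L s z d, if h : τ < d + 1 then (if k ⟨τ, h⟩ = ℓ then x k else 0) else 0

/-- Maximum deadline `d_max` over all packet types. -/
def dmax {J : ℕ} (d : Fin J → ℕ) : ℕ := Finset.univ.sup d

/-- Objective of the stationary LP `ES(λ, C)`:
`∑_j w_j λ_j ∑_{k ∈ K_j} x_{jk}`. -/
noncomputable def ESObj (L : Finset (V × V)) {J : ℕ} (src dst : Fin J → V)
    (d : Fin J → ℕ) (w lam : Fin J → ℝ)
    (x : (j : Fin J) → (Fin (d j + 1) → V × V) → ℝ) : ℝ :=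
  ∑ j, w j * lam j * ∑ k ∈ RS L (src j) (dst j) (d j), x j k

/-- Feasibility for the stationary LP `ES(λ, C)`: `x ≥ 0`, `∑_{k ∈ K_j} x_{jk} ≤ 1` for
every `j`, and `∑_j λ_j ∑_{τ=0}^{d_j} ∑_{k ∈ K_j : k_τ = ℓ} x_{jk} ≤ C_ℓ` for `ℓ ∈ L`. -/
def ESFeasible (L : Finset (V × V)) (C : V × V → ℝ) {J : ℕ} (src dst : Fin J → V)
    (d : Fin J → ℕ) (lam : Fin J → ℝ)
    (x : (j : Fin J) → (Fin (d j + 1) → V × V) → ℝ) : Prop :=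
  (∀ j k, 0 ≤ x j k) ∧
  (∀ j, ∑ k ∈ RS L (src j) (dst j) (d j), x j k ≤ 1) ∧
  (∀ ℓ ∈ L, ∑ j, lam j *
      ∑ τ ∈ Finset.range (d j + 1),
        schedAt L (src j) (dst j) (d j) (x j) τ ℓ ≤ C ℓ)

/-- `W_ES(λ, C)`: the optimal value of the stationary LP `ES(λ, C)`. -/
noncomputable def ESOpt (L : Finset (V × V)) (C : V × V → ℝ) {J : ℕ}
    (src dst : Fin J → V) (d : Fin J → ℕ) (w lam : Fin J → ℝ) : ℝ :=
  sSup {r : ℝ | ∃ x, ESFeasible L C src dst d lam x ∧ ESObj L src dst d w lam x = r}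

theorem schedAt_const_mul {V : Type} [Fintype V] [DecidableEq V]
    (L : Finset (V × V)) (s z : V) (d : ℕ) (c : ℝ)
    (x : (Fin (d + 1) → V × V) → ℝ) (τ : ℕ) (ℓ : V × V) :
    schedAt L s z d (fun k => c * x k) τ ℓ = c * schedAt L s z d x τ ℓ := by
  unfold schedAt
  rw [Finset.mul_sum]
  refine Finset.sum_congr rfl fun k _ => ?_
  split_ifs <;> simp

theorem schedAt_nonneg {V : Type} [Fintype V] [DecidableEq V]
    (L : Finset (V × V)) (s z : V) (d : ℕ)
    (x : (Fin (d + 1) → V × V) → ℝ) (hx : ∀ k, 0 ≤ x k) (τ : ℕ) (ℓ : V × V) :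
    0 ≤ schedAt L s z d x τ ℓ := by
  unfold schedAt
  refine Finset.sum_nonneg fun k _ => ?_
  split_ifs
  · exact hx k
  · exact le_rfl
  · exact le_rfl

theorem ESObj_const_mul {V : Type} [Fintype V] [DecidableEq V]
    (L : Finset (V × V)) {J : ℕ} (src dst : Fin J → V) (d : Fin J → ℕ) (w lam : Fin J → ℝ)
    (c : ℝ) (x : (j : Fin J) → (Fin (d j + 1) → V × V) → ℝ) :
    ESObj L src dst d w lam (fun j k => c * x j k) = c * ESObj L src dst d w lam x := by
  simp only [ESObj, ← Finset.mul_sum]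
  rw [Finset.mul_sum]
  exact Finset.sum_congr rfl fun j _ => by ring

theorem const_mul_ESObj_le {V : Type} [Fintype V] [DecidableEq V]
    (L : Finset (V × V)) {J : ℕ} (src dst : Fin J → V) (d : Fin J → ℕ) (w lam mu : Fin J → ℝ)
    (hw : ∀ j, 0 ≤ w j) (c : ℝ) (h : ∀ j, c * lam j ≤ mu j)
    (x : (j : Fin J) → (Fin (d j + 1) → V × V) → ℝ) (hx : ∀ j k, 0 ≤ x j k) :
    c * ESObj L src dst d w lam x ≤ ESObj L src dst d w mu x := by
  unfold ESObj
  rw [Finset.mul_sum]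
  refine Finset.sum_le_sum fun j _ => ?_
  have hS : 0 ≤ ∑ k ∈ RS L (src j) (dst j) (d j), x j k := Finset.sum_nonneg fun k _ => hx j k
  have := mul_le_mul_of_nonneg_right (h j) (mul_nonneg (hw j) hS)
  linarith

theorem ESFeasible.const_mul {V : Type} [Fintype V] [DecidableEq V]
    {L : Finset (V × V)} {C : V × V → ℝ} {J : ℕ} {src dst : Fin J → V} {d : Fin J → ℕ}
    {lam mu : Fin J → ℝ} {x : (j : Fin J) → (Fin (d j + 1) → V × V) → ℝ}
    (hx : ESFeasible L C src dst d lam x) {c : ℝ} (hc : 0 ≤ c) (hc1 : c ≤ 1)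
    (h : ∀ j, c * mu j ≤ lam j) :
    ESFeasible L C src dst d mu (fun j k => c * x j k) := by
  obtain ⟨hpos, hone, hcap⟩ := hx
  refine ⟨fun j k => mul_nonneg hc (hpos j k), fun j => ?_, fun ℓ hℓ => ?_⟩
  · rw [← Finset.mul_sum]
    exact mul_le_one₀ hc1 (Finset.sum_nonneg fun k _ => hpos j k) (hone j)
  · refine le_trans (Finset.sum_le_sum fun j _ => ?_) (hcap ℓ hℓ)
    simp only [schedAt_const_mul, ← Finset.mul_sum]
    have hT : 0 ≤ ∑ τ ∈ Finset.range (d j + 1),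
        schedAt L (src j) (dst j) (d j) (x j) τ ℓ :=
      Finset.sum_nonneg fun τ _ => schedAt_nonneg _ _ _ _ _ (hpos j) _ _
    have := mul_le_mul_of_nonneg_right (h j) hT
    linarith

theorem ESFeasible.zero {V : Type} [Fintype V] [DecidableEq V]
    {L : Finset (V × V)} {C : V × V → ℝ} (hC : ∀ ℓ ∈ L, 0 ≤ C ℓ) {J : ℕ}
    {src dst : Fin J → V} {d : Fin J → ℕ} {lam : Fin J → ℝ} :
    ESFeasible L C src dst d lam (fun _ _ => 0) := by
  refine ⟨fun _ _ => le_rfl, fun j => by simp, fun ℓ hℓ => ?_⟩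
  simpa [schedAt] using hC ℓ hℓ

theorem ESFeasible.obj_le_opt {V : Type} [Fintype V] [DecidableEq V]
    {L : Finset (V × V)} {C : V × V → ℝ} {J : ℕ} {src dst : Fin J → V} {d : Fin J → ℕ}
    {w lam : Fin J → ℝ} (hw : ∀ j, 0 ≤ w j) (hlam : ∀ j, 0 ≤ lam j)
    {x : (j : Fin J) → (Fin (d j + 1) → V × V) → ℝ} (hx : ESFeasible L C src dst d lam x) :
    ESObj L src dst d w lam x ≤ ESOpt L C src dst d w lam := by
  refine le_csSup ⟨∑ j, w j * lam j, ?_⟩ ⟨x, hx, rfl⟩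
  rintro r ⟨y, hy, rfl⟩
  exact Finset.sum_le_sum fun j _ =>
    mul_le_of_le_one_right (mul_nonneg (hw j) (hlam j)) (hy.2.1 j)

/-- LP perturbation: if the estimated rates `λ̂_j` satisfy
`(1-ε₀) λ_j ≤ λ̂_j ≤ (1+ε₀) λ_j` and `x̂` is an optimal solution of `ES(λ̂, C)`, then the
scaled solution `x̃ = (1-ε₀) x̂` is feasible for `ES(λ, C)` and its objective value with
respect to `λ` is at least `(1 - 4ε₀) W_ES(λ, C)`. -/
theorem stmt11 {V : Type} [Fintype V] [DecidableEq V]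
    (L : Finset (V × V)) (C : V × V → ℝ) (hC : ∀ ℓ ∈ L, 0 < C ℓ)
    {J : ℕ} (hJ : 1 ≤ J) (src dst : Fin J → V) (d : Fin J → ℕ)
    (w : Fin J → ℝ) (hw : ∀ j, 0 ≤ w j)
    (ε₀ : ℝ) (hε₀ : 0 < ε₀) (hε₀1 : ε₀ < 1)
    (lam lamhat : Fin J → ℝ) (hlam : ∀ j, 0 ≤ lam j) (hlamhat : ∀ j, 0 ≤ lamhat j)
    (hest : ∀ j, (1 - ε₀) * lam j ≤ lamhat j ∧ lamhat j ≤ (1 + ε₀) * lam j)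
    (xhat : (j : Fin J) → (Fin (d j + 1) → V × V) → ℝ)
    (hfeas : ESFeasible L C src dst d lamhat xhat)
    (hopt : ESObj L src dst d w lamhat xhat = ESOpt L C src dst d w lamhat) :
    ESFeasible L C src dst d lam (fun j k => (1 - ε₀) * xhat j k) ∧
    (1 - 4 * ε₀) * ESOpt L C src dst d w lam ≤
      ESObj L src dst d w lam (fun j k => (1 - ε₀) * xhat j k) := by
  have hlo : 0 ≤ 1 - ε₀ := by linarith
  have hup : 0 < 1 + ε₀ := by linarith
  refine ⟨hfeas.const_mul hlo (by linarith) fun j => (hest j).1, ?_⟩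
  rw [ESObj_const_mul]
  have hopt_le : (1 - ε₀) * ESOpt L C src dst d w lam ≤
      (1 + ε₀) * ESOpt L C src dst d w lamhat := by
    rw [← le_div_iff₀' (by linarith : 0 < 1 - ε₀)]
    refine csSup_le ⟨_, _, ESFeasible.zero fun ℓ hℓ => (hC ℓ hℓ).le, rfl⟩ ?_
    rintro r ⟨x, hx, rfl⟩
    rw [le_div_iff₀' (by linarith : 0 < 1 - ε₀)]
    have hscaled : ESFeasible L C src dst d lamhat (fun j k => (1 + ε₀)⁻¹ * x j k) :=
      hx.const_mul (inv_nonneg.2 hup.le) (inv_le_one_of_one_le₀ (by linarith)) fun j =>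
        (inv_mul_le_iff₀ hup).2 (hest j).2
    have hle := hscaled.obj_le_opt hw hlamhat
    rw [ESObj_const_mul, inv_mul_le_iff₀ hup] at hle
    exact (const_mul_ESObj_le L src dst d w lam lamhat hw _ (fun j => (hest j).1) x hx.1).trans hle
  have hobj_le : ESOpt L C src dst d w lamhat ≤ (1 + ε₀) * ESObj L src dst d w lam xhat := by
    rw [← hopt, ← inv_mul_le_iff₀ hup]
    exact const_mul_ESObj_le L src dst d w lamhat lam hw _
      (fun j => (inv_mul_le_iff₀ hup).2 (hest j).2) xhat hfeas.1
  have hopt_nonneg : 0 ≤ ESOpt L C src dst d w lam := by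
    have := (ESFeasible.zero (src := src) (dst := dst) (d := d) (lam := lam)
      fun ℓ hℓ => (hC ℓ hℓ).le).obj_le_opt hw hlam
    simpa [ESObj] using this
  refine le_of_mul_le_mul_left ?_ (pow_pos hup 2)
  calc (1 + ε₀) ^ 2 * ((1 - 4 * ε₀) * ESOpt L C src dst d w lam)
      = ((1 + ε₀) ^ 2 * (1 - 4 * ε₀)) * ESOpt L C src dst d w lam := by ring
    _ ≤ (1 - ε₀) ^ 2 * ESOpt L C src dst d w lam := by
        refine mul_le_mul_of_nonneg_right ?_ hopt_nonneg
        have : 0 ≤ 8 * ε₀ ^ 2 + 4 * ε₀ ^ 3 := by positivity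
        linarith
    _ = (1 - ε₀) * ((1 - ε₀) * ESOpt L C src dst d w lam) := by ring
    _ ≤ (1 - ε₀) * ((1 + ε₀) * ((1 + ε₀) * ESObj L src dst d w lam xhat)) :=
        mul_le_mul_of_nonneg_left
          (hopt_le.trans (mul_le_mul_of_nonneg_left hobj_le hup.le)) hlo
    _ = (1 + ε₀) ^ 2 * ((1 - ε₀) * ESObj L src dst d w lam xhat) := by ring
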